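/- Differentiating the orthogonality relation ∫_0^1 P_n(x,t) P_{n-1}(x,t) w(x,t) dx = 0 with respect to t gives (d/dt) p(n,t) = r_n(t) − y_n(t) − n, where p(n,t) is the coefficient of x^{n-1} in P_n(x,t). -/

import Mathlib

open MeasureTheory Polynomial

open Filter Topology in
/-- Differentiation of a convolution-type integral, with the derivative thrown on the factor `g`
vanishing at both endpoints; the other factor only has to be continuous. -/
theorem hasDerivAt_integral_mul_comp_sub {a b : ℝ} (hab : a ≤ b) {g g' W : ℝ → ℝ}
    (hg : ContinuousOn g (Set.Icc a b)) (hg' : ∀ x ∈ Set.Ioo a b, HasDerivAt g (g' x) x)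
    (hint : IntervalIntegrable g' volume a b) (ha : g a = 0) (hb : g b = 0)
    (hW : Continuous W) (t : ℝ) :
    HasDerivAt (fun s => ∫ x in a..b, g x * W (x - s)) (∫ x in a..b, g' x * W (x - t)) t := by
  set V : ℝ → ℝ := fun u => ∫ x in (0 : ℝ)..u, W x with hVdef
  have hV : ∀ u, HasDerivAt V (W u) u := fun u => (hW.integral_hasStrictDerivAt 0 u).hasDerivAt
  have hVc : Continuous V := continuous_iff_continuousAt.2 fun u => (hV u).continuousAt
  have hparts : ∀ s, ∫ x in a..b, g x * W (x - s) = ∫ x in a..b, g' x * (-V (x - s)) := by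
    intro s
    have := intervalIntegral.integral_mul_deriv_eq_deriv_mul_of_hasDerivAt
      (u := g) (v := fun x => V (x - s)) (u' := g') (v' := fun x => W (x - s)) (a := a) (b := b)
      (by rwa [Set.uIcc_of_le hab]) (by fun_prop)
      (by simpa [hab] using hg')
      (fun x _ => by simpa using (hV (x - s)).comp_sub_const x s)
      hint (Continuous.intervalIntegrable (by fun_prop) _ _)
    rw [this, ha, hb]
    simp
  simp_rw [hparts]
  obtain ⟨C, hC⟩ := (isCompact_Icc (a := a - t - 1) (b := b - t + 1)).exists_bound_of_continuousOn
    hW.continuousOn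
  have hmeas : ∀ f : ℝ → ℝ, Continuous f →
      IntervalIntegrable (fun x => g' x * f x) volume a b :=
    fun f hf => hint.mul_continuousOn hf.continuousOn
  refine (intervalIntegral.hasDerivAt_integral_of_dominated_loc_of_deriv_le
    (F := fun s x => g' x * (-V (x - s))) (F' := fun s x => g' x * W (x - s))
    (bound := fun x => ‖g' x‖ * C) (s := Metric.ball t 1) (Metric.ball_mem_nhds _ one_pos)
    (Eventually.of_forall fun s => ?_) ?_ ?_ ?_ ?_ ?_).2
  · exact (hmeas (fun x => -V (x - s)) (by fun_prop)).aestronglyMeasurable_restrict_uIoc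
  · exact hmeas (fun x => -V (x - t)) (by fun_prop)
  · exact (hmeas (fun x => W (x - t)) (by fun_prop)).aestronglyMeasurable_restrict_uIoc
  · refine Eventually.of_forall fun x hx s hs => ?_
    rw [Set.uIoc_of_le hab] at hx
    rw [Metric.mem_ball, Real.dist_eq, abs_lt] at hs
    rw [norm_mul]
    gcongr
    exact hC _ ⟨by linarith [hx.1, hs.2], by linarith [hx.2, hs.1]⟩
  · exact hint.norm.mul_const C
  · refine Eventually.of_forall fun x _ s _ => ?_
    have h1 : HasDerivAt (fun s => V (x - s)) (-W (x - s)) s := (hV (x - s)).comp_const_sub x s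
    simpa using h1.neg.const_mul (g' x)

theorem continuous_abs_rpow_mul_step {γ : ℝ} (hγ : 0 < γ) (A B : ℝ) :
    Continuous fun u : ℝ => |u| ^ γ * (A + B * (if 0 < u then (1 : ℝ) else 0)) := by
  have h : (fun u : ℝ => |u| ^ γ * (A + B * (if 0 < u then (1 : ℝ) else 0)))
      = fun u => A * |u| ^ γ + B * (max u 0) ^ γ := by
    funext u
    rcases lt_or_ge 0 u with hu | hu
    · simp [hu, abs_of_pos hu, hu.le]
      ring
    · simp [hu, hu.not_gt, Real.zero_rpow hγ.ne']
      ring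
  rw [h]
  refine (continuous_const.mul ?_).add (continuous_const.mul ?_)
  · exact continuous_abs.rpow_const fun _ => Or.inr hγ.le
  · exact (continuous_id.max continuous_const).rpow_const fun _ => Or.inr hγ.le

/-- The Jacobi weight is continuous. -/
theorem continuous_rpow_mul_one_sub_rpow {α β : ℝ} (hα : 0 < α) (hβ : 0 < β) :
    Continuous fun x : ℝ => x ^ α * (1 - x) ^ β :=
  (continuous_id.rpow_const fun _ => Or.inr hα.le).mul
    ((continuous_const.sub continuous_id).rpow_const fun _ => Or.inr hβ.le)

theorem intervalIntegrable_rpow_mul_one_sub_rpow_div {α β : ℝ} (hα : 0 < α) (hβ : 0 < β) :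
    IntervalIntegrable (fun x : ℝ => x ^ α * (1 - x) ^ β / x) volume 0 1 := by
  have h1 : IntervalIntegrable (fun x : ℝ => x ^ (α - 1)) volume 0 1 :=
    intervalIntegral.intervalIntegrable_rpow' (by linarith)
  have h2 : Continuous fun x : ℝ => (1 - x) ^ β :=
    (continuous_const.sub continuous_id).rpow_const fun _ => Or.inr hβ.le
  refine (h1.mul_continuousOn h2.continuousOn).congr_uIoo fun x hx => ?_
  rw [Set.uIoo_of_le zero_le_one] at hx
  simp only [Real.rpow_sub hx.1, Real.rpow_one]
  ring

theorem intervalIntegrable_rpow_mul_one_sub_rpow_div_one_sub {α β : ℝ}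
    (hα : 0 < α) (hβ : 0 < β) :
    IntervalIntegrable (fun x : ℝ => x ^ α * (1 - x) ^ β / (1 - x)) volume 0 1 := by
  have h := (intervalIntegrable_rpow_mul_one_sub_rpow_div hβ hα).comp_sub_left 1
  simp only [sub_sub_cancel, sub_zero, sub_self] at h
  refine h.symm.congr fun x _ => ?_
  simp only [mul_comm]

/-- The `t`-derivative of the integral of a polynomial against the singularly perturbed Jacobi
weight, expressed without the singular factor `1 / (x - t)`. -/
theorem hasDerivAt_integral_eval_mul_weight {α β : ℝ} (hα : 0 < α) (hβ : 0 < β)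
    {W : ℝ → ℝ} (hW : Continuous W) (q : ℝ[X]) (t : ℝ) :
    HasDerivAt (fun s => ∫ x in (0 : ℝ)..1, q.eval x * (x ^ α * (1 - x) ^ β * W (x - s)))
      ((∫ x in (0 : ℝ)..1, q.derivative.eval x * (x ^ α * (1 - x) ^ β * W (x - t)))
        + α * (∫ x in (0 : ℝ)..1, q.eval x * (x ^ α * (1 - x) ^ β * W (x - t)) / x)
        - β * (∫ x in (0 : ℝ)..1, q.eval x * (x ^ α * (1 - x) ^ β * W (x - t)) / (1 - x)))
      t := by
  have hv := continuous_rpow_mul_one_sub_rpow hα hβ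
  have i1 : ∀ f : ℝ → ℝ, Continuous f → IntervalIntegrable
      (fun x => q.derivative.eval x * (x ^ α * (1 - x) ^ β * f x)) volume 0 1 := fun f hf =>
    (q.derivative.continuous.mul (hv.mul hf)).intervalIntegrable _ _
  have i2 : ∀ f : ℝ → ℝ, Continuous f → IntervalIntegrable
      (fun x => q.eval x * (x ^ α * (1 - x) ^ β * f x) / x) volume 0 1 := fun f hf =>
    ((intervalIntegrable_rpow_mul_one_sub_rpow_div hα hβ).mul_continuousOn
      (q.continuous.mul hf).continuousOn).congr fun x _ => by
        simp only [Pi.mul_apply]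
        ring
  have i3 : ∀ f : ℝ → ℝ, Continuous f → IntervalIntegrable
      (fun x => q.eval x * (x ^ α * (1 - x) ^ β * f x) / (1 - x)) volume 0 1 := fun f hf =>
    ((intervalIntegrable_rpow_mul_one_sub_rpow_div_one_sub hα hβ).mul_continuousOn
      (q.continuous.mul hf).continuousOn).congr fun x _ => by
        simp only [Pi.mul_apply]
        ring
  have hWt : Continuous fun x => W (x - t) := by fun_prop
  have key := hasDerivAt_integral_mul_comp_sub (a := 0) (b := 1) zero_le_one
    (g := fun x => q.eval x * (x ^ α * (1 - x) ^ β))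
    (g' := fun x => q.derivative.eval x * (x ^ α * (1 - x) ^ β * 1)
      + α * (q.eval x * (x ^ α * (1 - x) ^ β * 1) / x)
      - β * (q.eval x * (x ^ α * (1 - x) ^ β * 1) / (1 - x))) (W := W)
    (q.continuous.mul hv).continuousOn ?_
    (((i1 _ continuous_const).add ((i2 _ continuous_const).const_mul α)).sub
      ((i3 _ continuous_const).const_mul β))
    (by simp [Real.zero_rpow hα.ne']) (by simp [Real.zero_rpow hβ.ne']) hW t
  · convert key using 1
    · simp only [mul_assoc]
    · rw [← intervalIntegral.integral_const_mul, ← intervalIntegral.integral_const_mul,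
        ← intervalIntegral.integral_add (i1 _ hWt) ((i2 _ hWt).const_mul α),
        ← intervalIntegral.integral_sub ((i1 _ hWt).add ((i2 _ hWt).const_mul α))
          ((i3 _ hWt).const_mul β)]
      congr 1
      funext x
      ring
  · intro x hx
    have hx1 : 0 < 1 - x := by linarith [hx.2]
    have d1 : HasDerivAt (fun x : ℝ => x ^ α) (α * x ^ (α - 1)) x :=
      Real.hasDerivAt_rpow_const (Or.inl hx.1.ne')
    have d2 : HasDerivAt (fun x : ℝ => (1 - x) ^ β) (-(β * (1 - x) ^ (β - 1))) x :=
      (Real.hasDerivAt_rpow_const (Or.inl hx1.ne')).comp_const_sub 1 x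
    refine ((q.hasDerivAt x).mul (d1.mul d2)).congr_deriv ?_
    simp only [Pi.mul_apply]
    rw [Real.rpow_sub hx.1, Real.rpow_sub hx1, Real.rpow_one, Real.rpow_one]
    ring

section OrthogonalPolynomials

variable {φ : ℝ[X] →ₗ[ℝ] ℝ} {P : ℕ → ℝ[X]} {h : ℕ → ℝ}

theorem coeff_eq_one_of_monic {p : ℝ[X]} {n : ℕ} (hm : p.Monic) (hd : p.natDegree = n) :
    p.coeff n = 1 :=
  hd ▸ hm

theorem degree_sub_C_coeff_mul_lt {p q : ℝ[X]} {n : ℕ} (hm : p.Monic) (hd : p.natDegree = n)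
    (hq : q.degree < ((n + 1 : ℕ) : WithBot ℕ)) : (q - C (q.coeff n) * p).degree < n := by
  rw [degree_lt_iff_coeff_zero] at hq ⊢
  intro m hnm
  have hpn := coeff_eq_one_of_monic hm hd
  rcases hnm.eq_or_lt with rfl | hlt
  · simp [hpn]
  · simp [hq m hlt, coeff_eq_zero_of_natDegree_lt (hd.trans_lt hlt)]

theorem orthogonal_of_degree_lt (hm : ∀ n, (P n).Monic) (hd : ∀ n, (P n).natDegree = n)
    (ho : ∀ m n, φ (P m * P n) = if m = n then h n else 0) {m n : ℕ} (hnm : n ≤ m)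
    {q : ℝ[X]} (hq : q.degree < n) : φ (q * P m) = 0 := by
  induction n generalizing q with
  | zero =>
    have : q = 0 := by
      rw [Nat.cast_zero] at hq
      by_contra h0
      exact absurd (zero_le_degree_iff.2 h0) hq.not_ge
    simp [this]
  | succ n ih =>
    have h1 := ih (by lia) (degree_sub_C_coeff_mul_lt (hm n) (hd n) hq)
    rw [sub_mul, mul_assoc, map_sub, C_mul', map_smul, ho, if_neg (by lia)] at h1
    simpa using h1

theorem apply_mul_eq_coeff_mul (hm : ∀ n, (P n).Monic) (hd : ∀ n, (P n).natDegree = n)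
    (ho : ∀ m n, φ (P m * P n) = if m = n then h n else 0) {n : ℕ}
    {q : ℝ[X]} (hq : q.degree < ((n + 1 : ℕ) : WithBot ℕ)) : φ (q * P n) = q.coeff n * h n := by
  have h1 := orthogonal_of_degree_lt hm hd ho le_rfl (degree_sub_C_coeff_mul_lt (hm n) (hd n) hq)
  rw [sub_mul, mul_assoc, map_sub, C_mul', map_smul, ho, if_pos rfl, sub_eq_zero] at h1
  simpa using h1

theorem eq_sum_of_orthogonal (hm : ∀ n, (P n).Monic) (hd : ∀ n, (P n).natDegree = n)
    (ho : ∀ m n, φ (P m * P n) = if m = n then h n else 0) (hh : ∀ n, h n ≠ 0) {n : ℕ}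
    {q : ℝ[X]} (hq : q.degree < n) :
    q = ∑ j ∈ Finset.range n, C (φ (q * P j) / h j) * P j := by
  induction n generalizing q with
  | zero =>
    rw [Nat.cast_zero] at hq
    by_contra h0
    exact absurd (zero_le_degree_iff.2 fun h => h0 (by simp [h])) hq.not_ge
  | succ n ih =>
    have h1 := ih (degree_sub_C_coeff_mul_lt (hm n) (hd n) hq)
    rw [sub_eq_iff_eq_add] at h1
    rw [Finset.sum_range_succ, apply_mul_eq_coeff_mul hm hd ho hq, mul_div_cancel_right₀ _ (hh n)]
    refine h1.trans (congrArg (· + _) (Finset.sum_congr rfl fun j hj => ?_))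
    have hj' : n ≠ j := (Finset.mem_range.1 hj).ne'
    rw [sub_mul, mul_assoc, map_sub, C_mul' (q.coeff n), map_smul, ho, if_neg hj', smul_zero,
      sub_zero]

theorem orthogonal_recursion (hm : ∀ n, (P n).Monic) (hd : ∀ n, (P n).natDegree = n)
    (ho : ∀ m n, φ (P m * P n) = if m = n then h n else 0) (hh : ∀ n, h n ≠ 0) (n : ℕ) :
    P n = X ^ n - ∑ j ∈ Finset.range n, C (φ (X ^ n * P j) / h j) * P j := by
  have hdeg : (X ^ n - P n).degree < (n : WithBot ℕ) := by
    rw [degree_lt_iff_coeff_zero]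
    intro m hnm
    have hpn := coeff_eq_one_of_monic (hm n) (hd n)
    rcases hnm.eq_or_lt with rfl | hlt
    · simp [hpn]
    · simp [coeff_X_pow, hlt.ne', coeff_eq_zero_of_natDegree_lt ((hd n).trans_lt hlt)]
  have h1 := eq_sum_of_orthogonal hm hd ho hh hdeg
  rw [sub_eq_iff_eq_add'] at h1
  rw [eq_sub_iff_add_eq]
  conv_rhs => rw [h1]
  refine congrArg (_ + ·) (Finset.sum_congr rfl fun j hj => ?_)
  rw [sub_mul, map_sub, ho, if_neg (Finset.mem_range.1 hj).ne', sub_zero]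

end OrthogonalPolynomials

section Family

open Filter Topology

variable {L : ℝ → ℝ[X] →ₗ[ℝ] ℝ} {P : ℕ → ℝ → ℝ[X]} {h : ℕ → ℝ → ℝ} {U : Set ℝ} {t : ℝ}

theorem apply_eq_sum_coeff (φ : ℝ[X] →ₗ[ℝ] ℝ) {q : ℝ[X]} {N : ℕ} (hq : q.natDegree < N)
    (p : ℝ[X]) : φ (p * q) = ∑ k ∈ Finset.range N, q.coeff k * φ (p * X ^ k) := by
  conv_lhs => rw [q.as_sum_range' N hq, Finset.mul_sum, map_sum]
  refine Finset.sum_congr rfl fun k _ => ?_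
  rw [← C_mul_X_pow_eq_monomial, C_mul', mul_smul_comm, map_smul, smul_eq_mul]

theorem continuousAt_apply_of_coeff (hL : ∀ q, ContinuousAt (fun s => L s q) t) (hU : U ∈ 𝓝 t)
    {R : ℝ → ℝ[X]} {N : ℕ} (hR : ∀ s ∈ U, (R s).natDegree < N)
    (hc : ∀ k, ContinuousAt (fun s => (R s).coeff k) t) :
    ContinuousAt (fun s => L s (R s)) t := by
  have h1 : ContinuousAt
      (fun s => ∑ k ∈ Finset.range N, (R s).coeff k * L s (1 * X ^ k)) t :=
    tendsto_finsetSum _ fun k _ => (hc k).mul (hL _)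
  refine h1.congr ?_
  filter_upwards [hU] with s hs
  rw [← apply_eq_sum_coeff (L s) (hR s hs), one_mul]

theorem continuousAt_norm_of_coeff (hL : ∀ q, ContinuousAt (fun s => L s q) t) (hU : U ∈ 𝓝 t)
    (hd : ∀ n, ∀ s ∈ U, (P n s).natDegree = n)
    (ho : ∀ m n, ∀ s ∈ U, L s (P m s * P n s) = if m = n then h n s else 0) {n : ℕ}
    (hc : ∀ k, ContinuousAt (fun s => (P n s).coeff k) t) :
    ContinuousAt (h n) t := by
  have h1 : ContinuousAt (fun s => L s (P n s * P n s)) t := by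
    refine continuousAt_apply_of_coeff hL hU (N := n + n + 1) (fun s hs => ?_) fun k => ?_
    · exact (natDegree_mul_le.trans (by rw [hd n s hs])).trans_lt (Nat.lt_succ_self _)
    · simp_rw [coeff_mul]
      exact tendsto_finsetSum _ fun x _ => (hc x.1).mul (hc x.2)
  refine h1.congr ?_
  filter_upwards [hU] with s hs
  rw [ho n n s hs, if_pos rfl]

theorem continuousAt_coeff_orthogonal (hL : ∀ q, ContinuousAt (fun s => L s q) t) (hU : U ∈ 𝓝 t)
    (hm : ∀ n, ∀ s ∈ U, (P n s).Monic) (hd : ∀ n, ∀ s ∈ U, (P n s).natDegree = n)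
    (ho : ∀ m n, ∀ s ∈ U, L s (P m s * P n s) = if m = n then h n s else 0)
    (hh : ∀ n, ∀ s ∈ U, h n s ≠ 0) (n k : ℕ) :
    ContinuousAt (fun s => (P n s).coeff k) t := by
  induction n using Nat.strong_induction_on generalizing k with
  | _ n ih =>
    have h1 : ContinuousAt (fun s => (X ^ n : ℝ[X]).coeff k
        - ∑ j ∈ Finset.range n, L s (X ^ n * P j s) / h j s * (P j s).coeff k) t := by
      refine continuousAt_const.sub (tendsto_finsetSum _ fun j hj => ?_)
      have hj' := ih j (Finset.mem_range.1 hj)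
      refine ContinuousAt.mul (ContinuousAt.div ?_ ?_ (hh j t (mem_of_mem_nhds hU))) (hj' k)
      · refine continuousAt_apply_of_coeff hL hU (N := n + j + 1) (fun s hs => ?_) fun i => ?_
        · refine natDegree_mul_le.trans_lt ?_
          rw [natDegree_X_pow, hd j s hs]
          lia
        · simp_rw [coeff_X_pow_mul']
          split_ifs
          exacts [hj' _, continuousAt_const]
      · exact continuousAt_norm_of_coeff hL hU hd ho hj'
    refine h1.congr ?_
    filter_upwards [hU] with s hs
    conv_rhs => rw [orthogonal_recursion (φ := L s) (P := fun n => P n s) (h := fun n => h n s)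
      (fun n => hm n s hs) (fun n => hd n s hs) (fun m n => ho m n s hs)
      (fun n => hh n s hs) n]
    simp

theorem HasDerivAt.continuousAt_mul {f g : ℝ → ℝ} {g' : ℝ} (hf : ContinuousAt f t)
    (hg : HasDerivAt g g' t) (h0 : g t = 0) :
    HasDerivAt (fun s => f s * g s) (f t * g') t := by
  rw [hasDerivAt_iff_tendsto_slope] at hg ⊢
  refine ((hf.tendsto.mono_left nhdsWithin_le_nhds).mul hg).congr fun s => ?_
  simp only [slope_def_field, h0]
  ring

theorem hasDerivAt_subleading_coeff {D : ℝ[X] → ℝ} (hL : ∀ q, HasDerivAt (fun s => L s q) (D q) t)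
    (hU : U ∈ 𝓝 t)
    (hm : ∀ n, ∀ s ∈ U, (P n s).Monic) (hd : ∀ n, ∀ s ∈ U, (P n s).natDegree = n)
    (ho : ∀ m n, ∀ s ∈ U, L s (P m s * P n s) = if m = n then h n s else 0)
    (hh : ∀ n, ∀ s ∈ U, h n s ≠ 0) (n : ℕ) :
    HasDerivAt (fun s => (P (n + 1) s).coeff n) (-(D (P (n + 1) t * P n t) / h n t)) t := by
  have htU := mem_of_mem_nhds hU
  have hc := continuousAt_coeff_orthogonal (fun q => (hL q).continuousAt) hU hm hd ho hh
  have hhc : ContinuousAt (h n) t :=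
    continuousAt_norm_of_coeff (fun q => (hL q).continuousAt) hU hd ho (hc n)
  set p := P (n + 1) t with hp
  have hD : D (p * P n t) = ∑ k ∈ Finset.range (n + 1), (P n t).coeff k * D (p * X ^ k) := by
    have hlt : (P n t).natDegree < n + 1 := by rw [hd n t htU]; exact n.lt_succ_self
    refine (hL (p * P n t)).unique ?_
    simp_rw [apply_eq_sum_coeff _ hlt p]
    exact HasDerivAt.fun_sum fun k _ => (hL _).const_mul _
  have hmain : HasDerivAt (fun s => p.coeff n - ∑ k ∈ Finset.range (n + 1),
      ((P n s).coeff k / h n s) * (L s (p * X ^ k) - L t (p * X ^ k)))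
      (-∑ k ∈ Finset.range (n + 1), ((P n t).coeff k / h n t) * D (p * X ^ k)) t := by
    refine HasDerivAt.const_sub _ (HasDerivAt.fun_sum fun k _ => ?_)
    exact HasDerivAt.continuousAt_mul ((hc n k).div hhc (hh n t htU))
      ((hL _).sub_const _) (sub_self _)
  have heq : (fun s => (P (n + 1) s).coeff n) =ᶠ[𝓝 t] fun s => p.coeff n
      - ∑ k ∈ Finset.range (n + 1),
        ((P n s).coeff k / h n s) * (L s (p * X ^ k) - L t (p * X ^ k)) := by
    filter_upwards [hU] with s hs
    have hlt : (P n s).natDegree < n + 1 := by rw [hd n s hs]; exact n.lt_succ_self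
    have hcoeff : ∀ r ∈ U, (P (n + 1) r).coeff (n + 1) = 1 := fun r hr =>
      coeff_eq_one_of_monic (hm _ r hr) (hd _ r hr)
    have hdiff : (p - P (n + 1) s).degree < ((n + 1 : ℕ) : WithBot ℕ) := by
      rw [degree_lt_iff_coeff_zero]
      intro m hnm
      rcases hnm.eq_or_lt with rfl | hlt'
      · simp [hp, hcoeff s hs, hcoeff t htU]
      · simp [hp, coeff_eq_zero_of_natDegree_lt ((hd _ s hs).trans_lt hlt'),
          coeff_eq_zero_of_natDegree_lt ((hd _ t htU).trans_lt hlt')]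
    have e1 : L s (p * P n s) = (p.coeff n - (P (n + 1) s).coeff n) * h n s := by
      have := apply_mul_eq_coeff_mul (φ := L s) (P := fun n => P n s) (h := fun n => h n s)
        (fun n => hm n s hs) (fun n => hd n s hs) (fun m n => ho m n s hs) hdiff
      rw [sub_mul, map_sub, ho _ _ s hs, if_neg (by lia), sub_zero] at this
      simpa using this
    have e2 : L t (p * P n s) = 0 := by
      rw [mul_comm]
      refine orthogonal_of_degree_lt (φ := L t) (P := fun n => P n t) (h := fun n => h n t)
        (fun n => hm n t htU) (fun n => hd n t htU) (fun m n => ho m n t htU) le_rfl ?_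
      exact degree_le_natDegree.trans_lt (by exact_mod_cast hlt)
    have e3 : ∑ k ∈ Finset.range (n + 1),
        ((P n s).coeff k / h n s) * (L s (p * X ^ k) - L t (p * X ^ k))
        = (L s (p * P n s) - L t (p * P n s)) / h n s := by
      rw [apply_eq_sum_coeff (L s) hlt p, apply_eq_sum_coeff (L t) hlt p,
        ← Finset.sum_sub_distrib, Finset.sum_div]
      exact Finset.sum_congr rfl fun k _ => by ring
    rw [e3, e1, e2, sub_zero, mul_div_cancel_right₀ _ (hh n s hs)]
    ring
  refine (hmain.congr_of_eventuallyEq heq).congr_deriv ?_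
  rw [hD, Finset.sum_div]
  exact congrArg _ (Finset.sum_congr rfl fun k _ => by ring)

end Family

/-- The linear functional `q ↦ ∫₀¹ q v` for a continuous weight `v`. -/
noncomputable def weightFunctional (v : ℝ → ℝ) (hv : Continuous v) : ℝ[X] →ₗ[ℝ] ℝ where
  toFun q := ∫ x in (0 : ℝ)..1, q.eval x * v x
  map_add' p q := by
    simp only [eval_add, add_mul]
    exact intervalIntegral.integral_add ((p.continuous.mul hv).intervalIntegrable _ _)
      ((q.continuous.mul hv).intervalIntegrable _ _)
  map_smul' c q := by
    simp only [eval_smul, smul_eq_mul, mul_assoc, RingHom.id_apply]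
    exact intervalIntegral.integral_const_mul _ _

/-- Differentiating the orthogonality relation with respect to `t` gives
`(d/dt) p(n,t) = r_n(t) − y_n(t) − n`. -/
theorem deriv_p_n (α β γ A B : ℝ)
    (hα : 0 < α) (hβ : 0 < β) (hγ : 0 < γ)
    (hA : 0 ≤ A) (hAB : 0 ≤ A + B)
    (w : ℝ → ℝ → ℝ)
    (hw : ∀ t x, w t x = x ^ α * (1 - x) ^ β * |x - t| ^ γ *
      (A + B * (if t < x then (1 : ℝ) else 0)))
    (P : ℕ → ℝ → Polynomial ℝ) (h : ℕ → ℝ → ℝ)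
    (hmonic : ∀ n, ∀ t ∈ Set.Ioo (0 : ℝ) 1, (P n t).Monic)
    (hdeg : ∀ n, ∀ t ∈ Set.Ioo (0 : ℝ) 1, (P n t).natDegree = n)
    (horth : ∀ m n, ∀ t ∈ Set.Ioo (0 : ℝ) 1,
      (∫ x in (0 : ℝ)..1, (P m t).eval x * (P n t).eval x * w t x)
        = if m = n then h n t else 0)
    (hpos : ∀ n, ∀ t ∈ Set.Ioo (0 : ℝ) 1, 0 < h n t)
    (n : ℕ) (hn : 1 ≤ n) (t : ℝ) (ht : t ∈ Set.Ioo (0 : ℝ) 1) :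
    deriv (fun s => (P n s).coeff (n - 1)) t
      = (β / h (n - 1) t) *
          (∫ y in (0 : ℝ)..1, (P n t).eval y * (P (n - 1) t).eval y * w t y / (1 - y))
        - (α / h (n - 1) t) *
          (∫ y in (0 : ℝ)..1, (P n t).eval y * (P (n - 1) t).eval y * w t y / y)
        - n := by
  set W : ℝ → ℝ := fun u => |u| ^ γ * (A + B * (if 0 < u then (1 : ℝ) else 0))
  have hW : Continuous W := continuous_abs_rpow_mul_step hγ A B
  have hwW : ∀ s x, w s x = x ^ α * (1 - x) ^ β * W (x - s) := fun s x => by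
    rw [hw]
    simp only [W, sub_pos, mul_assoc]
  have hwc : ∀ s, Continuous (w s) := fun s => by
    rw [funext (hwW s)]
    exact (continuous_rpow_mul_one_sub_rpow hα hβ).mul (by fun_prop)
  set L : ℝ → ℝ[X] →ₗ[ℝ] ℝ := fun s => weightFunctional (w s) (hwc s)
  have hLdef : ∀ s q, L s q = ∫ x in (0 : ℝ)..1, q.eval x * w s x := fun _ _ => rfl
  have hL : ∀ q, HasDerivAt (fun s => L s q)
      (L t q.derivative + α * (∫ x in (0 : ℝ)..1, q.eval x * w t x / x)
        - β * (∫ x in (0 : ℝ)..1, q.eval x * w t x / (1 - x))) t := fun q => by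
    simp only [hLdef, hwW]
    exact hasDerivAt_integral_eval_mul_weight hα hβ hW q t
  have ho : ∀ m n, ∀ s ∈ Set.Ioo (0 : ℝ) 1,
      L s (P m s * P n s) = if m = n then h n s else 0 := fun m n s hs => by
    simp only [hLdef, eval_mul, horth m n s hs]
  obtain ⟨m, rfl⟩ : ∃ m, n = m + 1 := ⟨n - 1, by lia⟩
  have hmain := hasDerivAt_subleading_coeff hL (Ioo_mem_nhds ht.1 ht.2) hmonic hdeg ho
    (fun n s hs => (hpos n s hs).ne') m
  have hder : L t (P (m + 1) t * P m t).derivative = (m + 1) * h m t := by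
    have e1 : (P (m + 1) t).derivative.degree < ((m + 1 : ℕ) : WithBot ℕ) := by
      have := degree_derivative_lt (hmonic (m + 1) t ht).ne_zero
      rwa [degree_eq_natDegree (hmonic (m + 1) t ht).ne_zero, hdeg _ t ht] at this
    have e2 : (P m t).derivative.degree < ((m + 1 : ℕ) : WithBot ℕ) := by
      have := degree_derivative_lt (hmonic m t ht).ne_zero
      rw [degree_eq_natDegree (hmonic m t ht).ne_zero, hdeg _ t ht] at this
      exact this.trans (by exact_mod_cast m.lt_succ_self)
    have hcoeff := coeff_eq_one_of_monic (hmonic (m + 1) t ht) (hdeg _ t ht)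
    have f1 := apply_mul_eq_coeff_mul (φ := L t) (P := fun n => P n t) (h := fun n => h n t)
      (fun n => hmonic n t ht) (fun n => hdeg n t ht) (fun m n => ho m n t ht) e1
    have f2 := orthogonal_of_degree_lt (φ := L t) (P := fun n => P n t) (h := fun n => h n t)
      (fun n => hmonic n t ht) (fun n => hdeg n t ht) (fun m n => ho m n t ht) le_rfl e2
    rw [coeff_derivative, hcoeff, one_mul] at f1
    rw [derivative_mul, map_add, f1, mul_comm (P (m + 1) t), f2, add_zero]
  have hhm := (hpos m t ht).ne'
  simp only [Nat.add_sub_cancel]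
  rw [hmain.deriv, hder]
  simp only [eval_mul]
  push_cast
  field_simp
  ring
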